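/- In the first-price auction, for every equilibrium strategy profile, every utility maximizer i ∈ B_u, and every auction j with rw(j) = i, there exists x ∈ [0,1] such that E[val i j] = x · v i j and Σ_{i' ≠ i} E[p i' j] ≥ (1 − x + x·ln x) · v i j (with the convention 0·ln 0 = 0). -/

import Mathlib

open MeasureTheory Finset
open scoped Classical

namespace FPA

variable {n m : ℕ}

/-- Bidder `i` wins auction `j` under bid profile `b`: highest bid, ties broken
in favor of larger value, then smaller index. -/
def Wins (v b : Fin n → Fin m → ℝ) (j : Fin m) (i : Fin n) : Prop :=
  ∀ i', i' ≠ i →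
    b i' j < b i j ∨ (b i' j = b i j ∧ (v i' j < v i j ∨ (v i' j = v i j ∧ i < i')))

/-- Indicator that bidder `i` wins auction `j`. -/
noncomputable def xind (v b : Fin n → Fin m → ℝ) (j : Fin m) (i : Fin n) : ℝ :=
  if Wins v b j i then 1 else 0

noncomputable def valij (v b : Fin n → Fin m → ℝ) (i : Fin n) (j : Fin m) : ℝ :=
  xind v b j i * v i j

noncomputable def payij (v b : Fin n → Fin m → ℝ) (i : Fin n) (j : Fin m) : ℝ :=
  xind v b j i * b i j

/-- Admissible strategy: probability distribution over nonnegative bid vectors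
with finite expectations. -/
def Admissible (σ : Measure (Fin m → ℝ)) : Prop :=
  IsProbabilityMeasure σ ∧ (∀ᵐ β ∂σ, ∀ j, 0 ≤ β j) ∧ ∀ j, Integrable (fun β => β j) σ

noncomputable def EValij (v : Fin n → Fin m → ℝ) (μ : Fin n → Measure (Fin m → ℝ))
    (i : Fin n) (j : Fin m) : ℝ :=
  ∫ b, valij v b i j ∂(Measure.pi μ)

noncomputable def EPayij (v : Fin n → Fin m → ℝ) (μ : Fin n → Measure (Fin m → ℝ))
    (i : Fin n) (j : Fin m) : ℝ :=
  ∫ b, payij v b i j ∂(Measure.pi μ)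

noncomputable def EVal (v : Fin n → Fin m → ℝ) (μ : Fin n → Measure (Fin m → ℝ))
    (i : Fin n) : ℝ :=
  ∑ j, EValij v μ i j

noncomputable def EPay (v : Fin n → Fin m → ℝ) (μ : Fin n → Measure (Fin m → ℝ))
    (i : Fin n) : ℝ :=
  ∑ j, EPayij v μ i j

noncomputable def EUtil (v : Fin n → Fin m → ℝ) (μ : Fin n → Measure (Fin m → ℝ))
    (i : Fin n) : ℝ :=
  EVal v μ i - EPay v μ i

/-- A utility maximizer best responds: no admissible deviation improves expected utility. -/
def UtilBest (v : Fin n → Fin m → ℝ) (μ : Fin n → Measure (Fin m → ℝ)) (i : Fin n) : Prop :=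
  ∀ σ, Admissible σ → EUtil v (Function.update μ i σ) i ≤ EUtil v μ i

/-- A value maximizer best responds: its ROI constraint holds and no admissible
deviation satisfying the ROI constraint yields more expected value. -/
def ValBest (v : Fin n → Fin m → ℝ) (μ : Fin n → Measure (Fin m → ℝ)) (i : Fin n) : Prop :=
  EPay v μ i ≤ EVal v μ i ∧
    ∀ σ, Admissible σ →
      EPay v (Function.update μ i σ) i ≤ EVal v (Function.update μ i σ) i →
      EVal v (Function.update μ i σ) i ≤ EVal v μ i

/-- Equilibrium: all strategies admissible, every utility maximizer in `Bu` and
every value maximizer in `Bv` best responds. -/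
def Equilibrium (v : Fin n → Fin m → ℝ) (Bu Bv : Finset (Fin n))
    (μ : Fin n → Measure (Fin m → ℝ)) : Prop :=
  (∀ i, Admissible (μ i)) ∧ (∀ i ∈ Bu, UtilBest v μ i) ∧ (∀ i ∈ Bv, ValBest v μ i)

/-- The rightful winner of auction `j`: the bidder with the highest value,
ties broken toward the smaller index. -/
noncomputable def rwinner [NeZero n] (v : Fin n → Fin m → ℝ) (j : Fin m) : Fin n :=
  (Finset.univ.filter fun i => ∀ i', v i' j ≤ v i j).min' (by
    obtain ⟨i, -, hi⟩ := Finset.exists_max_image (Finset.univ : Finset (Fin n))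
      (fun i => v i j) Finset.univ_nonempty
    exact ⟨i, Finset.mem_filter.mpr ⟨Finset.mem_univ _, fun i' => hi i' (Finset.mem_univ _)⟩⟩)

end FPA

open MeasureTheory Finset

namespace FPA

/-- The integral of a function of the form `1 - u / (c - t)` up to `c - u`, where `u = y * c`. -/
theorem integral_one_sub_mul_inv {c y : ℝ} (hc : 0 < c) (hy0 : 0 ≤ y) :
    IntervalIntegrable (fun t => 1 - y * c * (c - t)⁻¹) volume 0 (c - y * c) ∧
      ∫ t in (0 : ℝ)..(c - y * c), (1 - y * c * (c - t)⁻¹) =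
        c - y * c + y * c * Real.log y := by
  rcases hy0.eq_or_lt with rfl | hy
  · simp
  have hyc : 0 < y * c := mul_pos hy hc
  have hmem : ∀ t ∈ Set.uIcc 0 (c - y * c), 0 < c - t := by
    intro t ht
    rw [Set.mem_uIcc] at ht
    rcases ht with ht | ht <;> linarith [ht.1, ht.2]
  have hint : IntervalIntegrable (fun t => y * c * (c - t)⁻¹) volume 0 (c - y * c) := by
    apply ContinuousOn.intervalIntegrable
    refine continuousOn_const.mul (ContinuousOn.inv₀ (by fun_prop) ?_)
    intro t ht
    exact (hmem t ht).ne'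
  refine ⟨intervalIntegrable_const.sub hint, ?_⟩
  rw [intervalIntegral.integral_sub intervalIntegrable_const hint,
    intervalIntegral.integral_const_mul,
    intervalIntegral.integral_comp_sub_left (fun s => s⁻¹) c, integral_inv]
  · have : (c - 0) / (c - (c - y * c)) = y⁻¹ := by
      rw [sub_sub_cancel, sub_zero]
      field_simp
    rw [this, Real.log_inv]
    simp
  · rw [Set.mem_uIcc]
    push Not
    constructor <;> intro h <;> linarith

/-- If bidding `b` is at least as profitable as any higher bid against a highest competing bid of
law `δ`, then the expected competing bid on the event of losing is bounded below. -/
theorem le_setIntegral_Ioi_of_bid_optimal (δ : Measure ℝ) [IsProbabilityMeasure δ]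
    (hδ : Integrable (fun d => d) δ) {v b : ℝ} (hb : 0 ≤ b) (hv : 0 ≤ v)
    (hopt : ∀ t, 0 ≤ t → δ.real (Set.Iic t) * (v - t) ≤ δ.real (Set.Iic b) * (v - b)) :
    (1 - δ.real (Set.Iic b) + δ.real (Set.Iic b) * Real.log (δ.real (Set.Iic b))) * v ≤
      ∫ d in Set.Ioi b, d ∂δ := by
  have hcompl : ∀ t, δ.real (Set.Ioi t) = 1 - δ.real (Set.Iic t) := fun t => by
    rw [← Set.compl_Iic, probReal_compl_eq_one_sub measurableSet_Iic]
  set y := δ.real (Set.Iic b) with hy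
  have hy0 : 0 ≤ y := measureReal_nonneg
  have hy1 : y ≤ 1 := measureReal_le_one
  have hylog : y * Real.log y ≤ 0 := Real.mul_log_nonpos hy0 hy1
  rcases le_or_gt v b with hvb | hbv
  · have h1 : ∫ d in Set.Ioi b, b ∂δ ≤ ∫ d in Set.Ioi b, d ∂δ :=
      setIntegral_mono_on (integrable_const b).integrableOn hδ.integrableOn measurableSet_Ioi
        fun d hd => le_of_lt hd
    rw [setIntegral_const, smul_eq_mul, hcompl] at h1
    nlinarith [mul_nonneg (sub_nonneg.2 hy1) (sub_nonneg.2 hvb)]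
  set M := v - b - y * (v - b) with hM
  have hM0 : 0 ≤ M := by nlinarith
  have hyv : 0 ≤ y * (v - b) := mul_nonneg hy0 (by linarith)
  let f : ℝ → ℝ := fun d => min (max (d - b) 0) M
  have hf0 : ∀ d, 0 ≤ f d := fun d => le_min (le_max_right _ _) hM0
  have hfM : ∀ d, f d ≤ M := fun d => min_le_right _ _
  have hfint : Integrable f δ := by
    refine Integrable.of_bound (C := M) (by fun_prop) (ae_of_all _ fun d => ?_)
    rw [Real.norm_of_nonneg (hf0 d)]
    exact hfM d
  have hsplit : b * (1 - y) + ∫ d, f d ∂δ ≤ ∫ d in Set.Ioi b, d ∂δ := by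
    have h1 : ∫ d, ((Set.Ioi b).indicator (fun _ => b) d + f d) ∂δ ≤
        ∫ d, (Set.Ioi b).indicator (fun d => d) d ∂δ := by
      refine integral_mono
        (((integrable_const b).indicator measurableSet_Ioi).add hfint)
        (hδ.indicator measurableSet_Ioi) fun d => ?_
      rcases lt_or_ge b d with h | h
      · have h2 : f d ≤ d - b := (min_le_left _ _).trans_eq (max_eq_left (by linarith))
        simp only [Set.indicator, Set.mem_Ioi, h, if_true]
        linarith
      · have h2 : f d ≤ 0 := (min_le_left _ _).trans_eq (max_eq_right (by linarith))
        simpa [Set.indicator, h.not_gt] using h2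
    rw [integral_add ((integrable_const b).indicator measurableSet_Ioi) hfint,
      integral_indicator measurableSet_Ioi, integral_indicator measurableSet_Ioi,
      setIntegral_const, smul_eq_mul, hcompl] at h1
    linarith
  have hlayer : ∫ d, f d ∂δ = ∫ t in (0 : ℝ)..M, δ.real {d | t ≤ f d} := by
    rw [intervalIntegral.integral_of_le hM0]
    exact hfint.integral_eq_integral_Ioc_meas_le (ae_of_all _ hf0) (ae_of_all _ hfM)
  obtain ⟨hint, hval⟩ := integral_one_sub_mul_inv (sub_pos.2 hbv) hy0
  have htail : (∫ t in (0 : ℝ)..M, (1 - y * (v - b) * (v - b - t)⁻¹)) ≤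
      ∫ t in (0 : ℝ)..M, δ.real {d | t ≤ f d} := by
    refine intervalIntegral.integral_mono_on_of_le_Ioo hM0 hint ?_ fun t ht => ?_
    · refine Antitone.intervalIntegrable fun s t hst => measureReal_mono ?_
      exact fun d hd => le_trans hst hd
    · have hpos : 0 < v - b - t := by linarith [ht.2]
      have h1 : δ.real (Set.Iic (b + t)) ≤ y * (v - b) * (v - b - t)⁻¹ := by
        rw [← div_eq_mul_inv, le_div_iff₀ hpos]
        have := hopt (b + t) (by linarith [ht.1])
        rwa [← sub_sub] at this
      have h2 : δ.real (Set.Ioi (b + t)) ≤ δ.real {d | t ≤ f d} := by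
        refine measureReal_mono fun d hd => ?_
        rw [Set.mem_Ioi] at hd
        exact le_min (le_max_of_le_left (by linarith)) ht.2.le
      rw [hcompl] at h2
      linarith
  rw [hval] at htail
  have hlog : Real.log y ≤ 0 := Real.log_nonpos hy0 hy1
  nlinarith [mul_nonneg (mul_nonneg hy0 hb) (neg_nonneg.2 hlog)]

/-- The two-player version of the local analysis: `β` is the law of the bid of the player with
value `v`, and `δ` is the law of the highest competing bid. -/
theorem le_integral_of_bid_law_optimal (β δ : Measure ℝ) [IsProbabilityMeasure β]
    [IsProbabilityMeasure δ] (hβ0 : ∀ᵐ b ∂β, 0 ≤ b) (hβ : Integrable (fun b => b) β)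
    (hδ : Integrable (fun d => d) δ) {v : ℝ} (hv : 0 ≤ v)
    (hopt : ∀ t, 0 ≤ t → δ.real (Set.Iic t) * (v - t) ≤
      ∫ p, {p : ℝ × ℝ | p.2 ≤ p.1}.indicator (fun p => v - p.1) p ∂(β.prod δ)) :
    (1 - (β.prod δ).real {p | p.2 ≤ p.1} +
        (β.prod δ).real {p | p.2 ≤ p.1} * Real.log ((β.prod δ).real {p | p.2 ≤ p.1})) * v ≤
      ∫ p, {p : ℝ × ℝ | p.1 < p.2}.indicator (fun p => p.2) p ∂(β.prod δ) := by
  have hle : MeasurableSet {p : ℝ × ℝ | p.2 ≤ p.1} := measurableSet_le measurable_snd measurable_fst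
  have hlt : MeasurableSet {p : ℝ × ℝ | p.1 < p.2} := measurableSet_lt measurable_fst measurable_snd
  set F : ℝ → ℝ := fun t => δ.real (Set.Iic t) with hF
  have hF0 : ∀ t, 0 ≤ F t := fun t => measureReal_nonneg
  have hF1 : ∀ t, F t ≤ 1 := fun t => measureReal_le_one
  have hFm : Measurable F := Monotone.measurable fun s t hst =>
    measureReal_mono (Set.Iic_subset_Iic.2 hst)
  have hFint : Integrable F β := by
    refine Integrable.of_bound (C := 1) hFm.aestronglyMeasurable (ae_of_all _ fun b => ?_)
    rw [Real.norm_of_nonneg (hF0 b)]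
    exact hF1 b
  have hx : (β.prod δ).real {p | p.2 ≤ p.1} = ∫ b, F b ∂β := by
    have hint : Integrable ({p : ℝ × ℝ | p.2 ≤ p.1}.indicator (1 : ℝ × ℝ → ℝ)) (β.prod δ) :=
      (integrable_const (1 : ℝ)).indicator hle
    rw [← integral_indicator_one hle, integral_prod _ hint]
    refine integral_congr_ae (ae_of_all _ fun b => ?_)
    have : (fun d => {p : ℝ × ℝ | p.2 ≤ p.1}.indicator (1 : ℝ × ℝ → ℝ) (b, d)) =
        (Set.Iic b).indicator 1 := by
      ext d; simp [Set.indicator]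
    simp only [this, integral_indicator_one measurableSet_Iic, hF]
  have hFb : Integrable (fun b => F b * (v - b)) β := by
    refine ((integrable_const v).sub hβ).bdd_mul (c := 1) hFm.aestronglyMeasurable
      (ae_of_all _ fun b => ?_)
    rw [Real.norm_of_nonneg (hF0 b)]
    exact hF1 b
  have hu : ∫ p, {p : ℝ × ℝ | p.2 ≤ p.1}.indicator (fun p => v - p.1) p ∂(β.prod δ) =
      ∫ b, F b * (v - b) ∂β := by
    have hint : Integrable ({p : ℝ × ℝ | p.2 ≤ p.1}.indicator fun p => v - p.1) (β.prod δ) :=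
      ((integrable_const v).sub (hβ.comp_fst δ)).indicator hle
    rw [integral_prod _ hint]
    refine integral_congr_ae (ae_of_all _ fun b => ?_)
    have : (fun d => {p : ℝ × ℝ | p.2 ≤ p.1}.indicator (fun p => v - p.1) (b, d)) =
        (Set.Iic b).indicator fun _ => v - b := by
      ext d; simp [Set.indicator]
    simp only [this, integral_indicator measurableSet_Iic, setIntegral_const, smul_eq_mul, hF]
  rw [hu] at hopt
  set u := ∫ b, F b * (v - b) ∂β with hudef
  have hae : ∀ᵐ b ∂β, F b * (v - b) = u := by
    have hgap : Integrable (fun b => u - F b * (v - b)) β := (integrable_const u).sub hFb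
    have h0 : ∫ b, (u - F b * (v - b)) ∂β = 0 := by
      rw [integral_sub (integrable_const u) hFb]
      simp [hudef]
    rw [integral_eq_zero_iff_of_nonneg_ae ?_ hgap] at h0
    · filter_upwards [h0] with b hb
      simp only [Pi.zero_apply] at hb
      linarith
    · filter_upwards [hβ0] with b hb
      simpa using hopt b hb
  have hgint : Integrable (fun b => F b * Real.log (F b)) β := by
    obtain ⟨C, hC⟩ := (isCompact_Icc (a := (0 : ℝ)) (b := 1)).exists_bound_of_continuousOn
      Real.continuous_mul_log.continuousOn
    exact Integrable.of_bound (C := C)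
      (Real.continuous_mul_log.measurable.comp hFm).aestronglyMeasurable
      (ae_of_all _ fun b => hC _ ⟨hF0 b, hF1 b⟩)
  have hjensen := Real.convexOn_mul_log.map_integral_le Real.continuous_mul_log.continuousOn
    isClosed_Ici (ae_of_all _ hF0) hFint hgint
  have hFint' : Integrable (fun b => 1 - F b) β := (integrable_const 1).sub hFint
  have hDint := (hδ.comp_snd β).indicator hlt
  rw [hx, integral_prod _ hDint]
  calc _ ≤ (1 - ∫ b, F b ∂β + ∫ b, F b * Real.log (F b) ∂β) * v := by gcongr
    _ = ∫ b, (1 - F b + F b * Real.log (F b)) * v ∂β := by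
      rw [integral_mul_const, integral_add hFint' hgint,
        integral_sub (integrable_const 1) hFint]
      simp
    _ ≤ _ := by
      refine integral_mono_ae
        ((hFint'.add hgint).mul_const v) hDint.integral_prod_left ?_
      filter_upwards [hβ0, hae] with b hb0 hb
      have : (fun d => {p : ℝ × ℝ | p.1 < p.2}.indicator (fun p => p.2) (b, d)) =
          (Set.Ioi b).indicator fun d => d := by
        ext d; simp [Set.indicator]
      simp only [this, integral_indicator measurableSet_Ioi]
      exact le_setIntegral_Ioi_of_bid_optimal δ hδ hb0 hv fun t ht => (hopt t ht).trans_eq hb.symm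

/-- Resampling coordinate `i` of a product measure. -/
theorem map_update_prod_pi {ι X : Type*} [Fintype ι] [DecidableEq ι] [MeasurableSpace X] (μ : ι → Measure X)
    [∀ k, IsProbabilityMeasure (μ k)] (i : ι) :
    (((Measure.pi μ).prod (μ i)).map fun p : (ι → X) × X => Function.update p.1 i p.2) =
      Measure.pi μ := by
  have hmeas : Measurable fun p : (ι → X) × X => Function.update p.1 i p.2 := measurable_update'
  refine (Measure.pi_eq fun s hs => ?_).symm
  rw [Measure.map_apply hmeas (MeasurableSet.univ_pi hs)]
  have hpre : (fun p : (ι → X) × X => Function.update p.1 i p.2) ⁻¹' Set.univ.pi s =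
      (Set.univ.pi (Function.update s i Set.univ)) ×ˢ s i := by
    ext ⟨b, x⟩
    simp only [Set.mem_preimage, Set.mem_univ_pi, Set.mem_prod]
    constructor
    · refine fun h => ⟨fun k => ?_, by simpa using h i⟩
      rcases eq_or_ne k i with rfl | hk
      · simp
      · simpa [Function.update_of_ne hk] using h k
    · rintro ⟨h, hx⟩ k
      rcases eq_or_ne k i with rfl | hk
      · simpa using hx
      · simpa [Function.update_of_ne hk] using h k
  rw [hpre, Measure.prod_prod, Measure.pi_pi, ← Finset.prod_erase_mul _ _ (Finset.mem_univ i),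
    ← Finset.prod_erase_mul (a := i) univ (fun k => μ k (s k)) (Finset.mem_univ i)]
  simp only [Function.update_self, measure_univ, mul_one]
  congr 1
  refine Finset.prod_congr rfl fun k hk => ?_
  rw [Function.update_of_ne (Finset.ne_of_mem_erase hk)]

section

variable {n m : ℕ}

/-- The highest nonnegative bid in auction `j` among the bidders other than `i`, or `0`. -/
noncomputable def maxOther [NeZero n] (i : Fin n) (j : Fin m) (b : Fin n → Fin m → ℝ) : ℝ :=
  (univ : Finset (Fin n)).sup' univ_nonempty fun k => if k = i then 0 else b k j

theorem maxOther_le_iff [NeZero n] {i : Fin n} {j : Fin m} {b : Fin n → Fin m → ℝ} {t : ℝ} :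
    maxOther i j b ≤ t ↔ 0 ≤ t ∧ ∀ k, k ≠ i → b k j ≤ t := by
  simp only [maxOther, Finset.sup'_le_iff, Finset.mem_univ, true_imp_iff]
  constructor
  · intro h
    exact ⟨by simpa using h i, fun k hk => by simpa [hk] using h k⟩
  · rintro ⟨h0, h⟩ k
    split_ifs with hk
    · exact h0
    · exact h k hk

theorem maxOther_nonneg [NeZero n] (i : Fin n) (j : Fin m) (b : Fin n → Fin m → ℝ) :
    0 ≤ maxOther i j b :=
  (maxOther_le_iff.1 le_rfl).1

theorem measurable_maxOther [NeZero n] (i : Fin n) (j : Fin m) : Measurable (maxOther i j) := by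
  have : maxOther i j = (univ : Finset (Fin n)).sup' univ_nonempty
      fun k (b : Fin n → Fin m → ℝ) => if k = i then 0 else b k j := by
    ext b
    simp [maxOther, Finset.sup'_apply]
  rw [this]
  refine Finset.measurable_sup' _ fun k _ => ?_
  split_ifs <;> fun_prop

theorem maxOther_update [NeZero n] (i : Fin n) (j : Fin m) (b : Fin n → Fin m → ℝ)
    (β : Fin m → ℝ) : maxOther i j (Function.update b i β) = maxOther i j b := by
  refine Finset.sup'_congr _ rfl fun k _ => ?_
  split_ifs with hk
  · rfl
  · rw [Function.update_of_ne hk]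

theorem wins_rwinner_iff [NeZero n] {v b : Fin n → Fin m → ℝ} {i : Fin n} {j : Fin m}
    (hrw : rwinner v j = i) : Wins v b j i ↔ ∀ k, k ≠ i → b k j ≤ b i j := by
  have hmem : i ∈ Finset.univ.filter fun i => ∀ i', v i' j ≤ v i j :=
    hrw ▸ Finset.min'_mem _ _
  have hmax : ∀ k, v k j ≤ v i j := (Finset.mem_filter.1 hmem).2
  refine ⟨fun h k hk => (h k hk).elim le_of_lt fun h => h.1.le, fun h k hk => ?_⟩
  rcases (h k hk).lt_or_eq with hlt | heq
  · exact Or.inl hlt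
  refine Or.inr ⟨heq, (hmax k).lt_or_eq.imp_right fun hvk => ⟨hvk, lt_of_le_of_ne ?_ hk.symm⟩⟩
  have hk' : k ∈ Finset.univ.filter fun i => ∀ i', v i' j ≤ v i j :=
    Finset.mem_filter.2 ⟨Finset.mem_univ _, fun i' => hvk ▸ hmax i'⟩
  exact hrw ▸ Finset.min'_le _ _ hk'

theorem wins_rwinner_iff_maxOther_le [NeZero n] {v b : Fin n → Fin m → ℝ} {i : Fin n} {j : Fin m}
    (hrw : rwinner v j = i) (hb : 0 ≤ b i j) : Wins v b j i ↔ maxOther i j b ≤ b i j := by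
  rw [wins_rwinner_iff hrw, maxOther_le_iff, and_iff_right hb]

theorem exists_wins [NeZero n] (v b : Fin n → Fin m → ℝ) (j : Fin m) :
    ∃ k, Wins v b j k ∧ ∀ k', b k' j ≤ b k j := by
  obtain ⟨k, -, hk⟩ := Finset.exists_max_image (univ : Finset (Fin n))
    (fun k => toLex (b k j, toLex (v k j, OrderDual.toDual k))) univ_nonempty
  have hle : ∀ k', b k' j < b k j ∨ b k' j = b k j ∧
      (v k' j < v k j ∨ v k' j = v k j ∧ k ≤ k') := fun k' => by
    simpa [Prod.Lex.le_iff] using hk k' (Finset.mem_univ _)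
  refine ⟨k, fun k' hne => ?_, fun k' => (hle k').elim le_of_lt fun h => h.1.le⟩
  exact (hle k').imp_right fun h => h.imp_right fun h => h.imp_right fun h =>
    h.imp_right fun h => lt_of_le_of_ne h hne.symm

theorem measurableSet_wins (v : Fin n → Fin m → ℝ) (j : Fin m) (i : Fin n) :
    MeasurableSet {b | Wins v b j i} := by
  have hb : ∀ k, Measurable fun b : Fin n → Fin m → ℝ => b k j := fun k => by fun_prop
  simp only [Wins, Set.ofPred_forall]
  refine MeasurableSet.iInter fun k => MeasurableSet.iInter fun _ => ?_
  refine (measurableSet_lt (hb k) (hb i)).union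
    ((measurableSet_eq_fun (hb k) (hb i)).inter (MeasurableSet.const _))

theorem measurable_xind (v : Fin n → Fin m → ℝ) (j : Fin m) (i : Fin n) :
    Measurable fun b => xind v b j i :=
  Measurable.ite (measurableSet_wins v j i) measurable_const measurable_const

theorem xind_nonneg (v b : Fin n → Fin m → ℝ) (j : Fin m) (i : Fin n) : 0 ≤ xind v b j i := by
  unfold xind; split_ifs <;> norm_num

theorem xind_le_one (v b : Fin n → Fin m → ℝ) (j : Fin m) (i : Fin n) : xind v b j i ≤ 1 := by
  unfold xind; split_ifs <;> norm_num

theorem measurable_valij (v : Fin n → Fin m → ℝ) (i : Fin n) (j : Fin m) :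
    Measurable fun b => valij v b i j :=
  (measurable_xind v j i).mul_const _

theorem measurable_payij (v : Fin n → Fin m → ℝ) (i : Fin n) (j : Fin m) :
    Measurable fun b => payij v b i j :=
  (measurable_xind v j i).mul (by fun_prop)

variable {μ : Fin n → Measure (Fin m → ℝ)}

theorem integrable_bid (hμ : ∀ k, Admissible (μ k)) (k : Fin n) (j : Fin m) :
    Integrable (fun b : Fin n → Fin m → ℝ => b k j) (Measure.pi μ) := by
  have := fun k => (hμ k).1
  exact (measurePreserving_eval μ k).integrable_comp_of_integrable ((hμ k).2.2 j)

theorem ae_bid_nonneg (hμ : ∀ k, Admissible (μ k)) :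
    ∀ᵐ b ∂(Measure.pi μ), ∀ k j, 0 ≤ b k j := by
  have := fun k => (hμ k).1
  exact ae_all_iff.2 fun k => (measurePreserving_eval μ k).quasiMeasurePreserving.ae (hμ k).2.1

theorem integrable_xind_mul (v : Fin n → Fin m → ℝ) (i : Fin n) (j : Fin m)
    {P : Measure (Fin n → Fin m → ℝ)} {f : (Fin n → Fin m → ℝ) → ℝ} (hf : Integrable f P) :
    Integrable (fun b => xind v b j i * f b) P := by
  refine hf.bdd_mul (c := 1) (measurable_xind v j i).aestronglyMeasurable (ae_of_all _ fun b => ?_)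
  rw [Real.norm_of_nonneg (xind_nonneg v b j i)]
  exact xind_le_one v b j i

theorem integrable_maxOther [NeZero n] (hμ : ∀ k, Admissible (μ k)) (i : Fin n) (j : Fin m) :
    Integrable (maxOther i j) (Measure.pi μ) := by
  refine Integrable.mono' (integrable_finsetSum univ fun k _ => (integrable_bid hμ k j).abs)
    (measurable_maxOther i j).aestronglyMeasurable (ae_of_all _ fun b => ?_)
  rw [Real.norm_of_nonneg (maxOther_nonneg i j b), maxOther_le_iff]
  refine ⟨Finset.sum_nonneg fun k _ => abs_nonneg _, fun k _ => (le_abs_self _).trans ?_⟩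
  exact Finset.single_le_sum (f := fun k => |b k j|) (fun k _ => abs_nonneg _) (Finset.mem_univ k)

/-- The bid of bidder `i` is independent of the highest competing bid. -/
theorem map_bid_prod_map_maxOther [NeZero n] [∀ k, IsProbabilityMeasure (μ k)]
    (i : Fin n) (j : Fin m) :
    ((Measure.pi μ).map fun b => b i j).prod ((Measure.pi μ).map (maxOther i j)) =
      (Measure.pi μ).map fun b => (b i j, maxOther i j b) := by
  have hD := measurable_maxOther (n := n) i j
  have hB : Measurable fun b : Fin n → Fin m → ℝ => b i j := by fun_prop
  have hj : Measurable fun β : Fin m → ℝ => β j := measurable_pi_apply j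
  have hβ : (Measure.pi μ).map (fun b => b i j) = (μ i).map fun β => β j := by
    rw [← (measurePreserving_eval μ i).map_eq, Measure.map_map hj (measurable_pi_apply i)]
    rfl
  have hupd : Measurable fun p : (Fin n → Fin m → ℝ) × (Fin m → ℝ) =>
      Function.update p.1 i p.2 := measurable_update'
  conv_rhs => rw [← map_update_prod_pi μ i]
  rw [Measure.map_map (hB.prodMk hD) hupd, hβ, ← Measure.prod_swap,
    Measure.map_prod_map _ _ hD hj, Measure.map_map measurable_swap (by fun_prop)]
  congr 1
  ext p <;> simp [maxOther_update]

/-- The deviation of bidder `i` that bids `t` in auction `j` and is unchanged elsewhere. -/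
theorem pi_update_map_update [∀ k, IsProbabilityMeasure (μ k)] (i : Fin n) (j : Fin m) (t : ℝ) :
    Measure.pi (Function.update μ i ((μ i).map fun β => Function.update β j t)) =
      (Measure.pi μ).map fun b => Function.update b i (Function.update (b i) j t) := by
  let f : Fin n → (Fin m → ℝ) → Fin m → ℝ :=
    fun k β => if k = i then Function.update β j t else β
  have hf : ∀ k, Measurable (f k) := fun k => by
    unfold f
    split_ifs
    · exact measurable_update_left
    · exact measurable_id
  have hprob : ∀ k, IsProbabilityMeasure ((μ k).map (f k)) :=
    fun k => Measure.isProbabilityMeasure_map (hf k).aemeasurable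
  have hpi := Measure.pi_map_pi (μ := μ) (f := f) fun k => (hf k).aemeasurable
  have hlhs : (fun (b : Fin n → Fin m → ℝ) k => f k (b k)) =
      fun b => Function.update b i (Function.update (b i) j t) := by
    ext b k : 2
    rcases eq_or_ne k i with rfl | hk
    · simp [f]
    · simp [f, hk]
  have hrhs : (fun k => (μ k).map (f k)) =
      Function.update μ i ((μ i).map fun β => Function.update β j t) := by
    ext k : 1
    rcases eq_or_ne k i with rfl | hk
    · simp [f]
    · simp [f, hk]
  rw [← hrhs, ← hpi, hlhs]

theorem admissible_map_update {σ : Measure (Fin m → ℝ)} (hσ : Admissible σ) (j : Fin m) {t : ℝ}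
    (ht : 0 ≤ t) : Admissible (σ.map fun β => Function.update β j t) := by
  obtain ⟨_, h0, hint⟩ := hσ
  have hm : Measurable fun β : Fin m → ℝ => Function.update β j t := measurable_update_left
  refine ⟨Measure.isProbabilityMeasure_map hm.aemeasurable, ?_, fun j' => ?_⟩
  · rw [ae_map_iff hm.aemeasurable (by
      simp only [Set.ofPred_forall]
      exact MeasurableSet.iInter fun k =>
        measurableSet_le measurable_const (measurable_pi_apply k))]
    filter_upwards [h0] with β hβ j'
    rcases eq_or_ne j' j with rfl | h
    · simpa using ht
    · simpa [h] using hβ j'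
  · rw [integrable_map_measure (measurable_pi_apply j').aestronglyMeasurable hm.aemeasurable]
    rcases eq_or_ne j' j with rfl | h
    · simp [Function.comp_def]
    · simpa [Function.comp_def, h] using hint j'

/-- A best response of a utility maximizer beats, in each auction, every fixed bid. -/
theorem UtilBest.local_le {v : Fin n → Fin m → ℝ} {i : Fin n}
    (hμ : ∀ k, Admissible (μ k)) (hbest : UtilBest v μ i) (j : Fin m) {t : ℝ} (ht : 0 ≤ t) :
    (∫ b, xind v (Function.update b i (Function.update (b i) j t)) j i ∂(Measure.pi μ)) *
        (v i j - t) ≤ EValij v μ i j - EPayij v μ i j := by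
  have := fun k => (hμ k).1
  have hT : Measurable fun b : Fin n → Fin m → ℝ =>
      Function.update b i (Function.update (b i) j t) := by
    have hcoord : Measurable fun b : Fin n → Fin m → ℝ => Function.update (b i) j t :=
      Measurable.comp (g := fun β : Fin m → ℝ => Function.update β j t)
        measurable_update_left (measurable_pi_apply i)
    exact measurable_update'.comp (measurable_id.prodMk hcoord)
  have hdev := hbest _ (admissible_map_update (hμ i) j ht)
  set σ := (μ i).map fun β => Function.update β j t with hσ
  have hval : ∀ j', EValij v (Function.update μ i σ) i j' =
      ∫ b, valij v (Function.update b i (Function.update (b i) j t)) i j' ∂(Measure.pi μ) :=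
    fun j' => by
      rw [EValij, hσ, pi_update_map_update,
        integral_map hT.aemeasurable (measurable_valij v i j').aestronglyMeasurable]
  have hpay : ∀ j', EPayij v (Function.update μ i σ) i j' =
      ∫ b, payij v (Function.update b i (Function.update (b i) j t)) i j' ∂(Measure.pi μ) :=
    fun j' => by
      rw [EPayij, hσ, pi_update_map_update,
        integral_map hT.aemeasurable (measurable_payij v i j').aestronglyMeasurable]
  have hcol : ∀ j', j' ≠ j → ∀ (b : Fin n → Fin m → ℝ) k,
      Function.update b i (Function.update (b i) j t) k j' = b k j' := fun j' hj b k => by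
    rcases eq_or_ne k i with rfl | hk
    · simp [hj]
    · simp [hk]
  have hxcol : ∀ j', j' ≠ j → ∀ b : Fin n → Fin m → ℝ,
      xind v (Function.update b i (Function.update (b i) j t)) j' i = xind v b j' i :=
    fun j' hj b => if_congr (by simp only [Wins, hcol j' hj]) rfl rfl
  have hval' : ∀ j' ∈ univ.erase j,
      EValij v (Function.update μ i σ) i j' = EValij v μ i j' := fun j' hj => by
    rw [hval]
    simp only [EValij, valij, hxcol j' (Finset.ne_of_mem_erase hj)]
  have hpay' : ∀ j' ∈ univ.erase j,
      EPayij v (Function.update μ i σ) i j' = EPayij v μ i j' := fun j' hj => by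
    rw [hpay]
    simp only [EPayij, payij, hxcol j' (Finset.ne_of_mem_erase hj),
      hcol j' (Finset.ne_of_mem_erase hj)]
  simp only [EUtil, EVal, EPay, ← Finset.add_sum_erase _ _ (Finset.mem_univ j)] at hdev
  rw [Finset.sum_congr rfl hval', Finset.sum_congr rfl hpay', hval, hpay] at hdev
  simp only [valij, payij, Function.update_self, integral_mul_const] at hdev
  linarith

/-- The bidders other than `i` jointly pay at least the highest of their bids when `i` loses. -/
theorem le_sum_payij [NeZero n] {v b : Fin n → Fin m → ℝ} {i : Fin n} {j : Fin m}
    (hb : ∀ k, 0 ≤ b k j) :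
    (if b i j < maxOther i j b then maxOther i j b else 0) ≤
      ∑ k ∈ univ.erase i, payij v b k j := by
  have hpay : ∀ k, 0 ≤ payij v b k j := fun k => mul_nonneg (xind_nonneg v b j k) (hb k)
  split_ifs with h
  · obtain ⟨k, hwin, hmax⟩ := exists_wins v b j
    have hD : maxOther i j b ≤ b k j := maxOther_le_iff.2 ⟨hb k, fun k' _ => hmax k'⟩
    have hki : k ≠ i := by
      rintro rfl
      exact hD.not_gt h
    refine hD.trans ?_
    have hk : payij v b k j = b k j := by simp [payij, xind, hwin]
    rw [← hk]
    exact Finset.single_le_sum (f := fun k => payij v b k j) (fun k _ => hpay k)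
      (Finset.mem_erase.2 ⟨hki, Finset.mem_univ k⟩)
  · exact Finset.sum_nonneg fun k _ => hpay k

end

end FPA

/-- local analysis, Lemma 3 of the paper. In any equilibrium of the
first-price auction, for every utility maximizer `i` and every auction `j` whose
rightful winner is `i`, there is `x ∈ [0,1]` with `E[val i j] = x * v i j` and
`∑_{i' ≠ i} E[p i' j] ≥ (1 - x + x ln x) * v i j`. -/
theorem fpa_local_analysis {n m : ℕ} [NeZero n]
    (v : Fin n → Fin m → ℝ) (hv : ∀ i j, 0 ≤ v i j)
    (Bu Bv : Finset (Fin n)) (hdisj : Disjoint Bu Bv) (hcover : Bu ∪ Bv = Finset.univ)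
    (μ : Fin n → Measure (Fin m → ℝ))
    (heq : FPA.Equilibrium v Bu Bv μ)
    (i : Fin n) (hi : i ∈ Bu) (j : Fin m) (hrw : FPA.rwinner v j = i) :
    ∃ x ∈ Set.Icc (0 : ℝ) 1,
      FPA.EValij v μ i j = x * v i j ∧
      ∑ i' ∈ Finset.univ.erase i, FPA.EPayij v μ i' j ≥
        (1 - x + x * Real.log x) * v i j := by
  obtain ⟨hμ, hbest, -⟩ := heq
  have := fun k => (hμ k).1
  set P := Measure.pi μ with hP
  have hD := FPA.measurable_maxOther (n := n) i j
  have hB : Measurable fun b : Fin n → Fin m → ℝ => b i j := by fun_prop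
  have hBD := hB.prodMk hD
  have hle : MeasurableSet {p : ℝ × ℝ | p.2 ≤ p.1} := measurableSet_le measurable_snd measurable_fst
  have hlt : MeasurableSet {p : ℝ × ℝ | p.1 < p.2} := measurableSet_lt measurable_fst measurable_snd
  have hwin : MeasurableSet {b : Fin n → Fin m → ℝ | FPA.maxOther i j b ≤ b i j} :=
    measurableSet_le hD hB
  have hxind : ∀ᵐ b ∂P, FPA.xind v b j i =
      {b : Fin n → Fin m → ℝ | FPA.maxOther i j b ≤ b i j}.indicator 1 b := by
    filter_upwards [FPA.ae_bid_nonneg hμ] with b hb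
    simp [FPA.xind, Set.indicator, FPA.wins_rwinner_iff_maxOther_le hrw (hb i j)]
  have hval : FPA.EValij v μ i j = P.real {b | FPA.maxOther i j b ≤ b i j} * v i j := by
    rw [FPA.EValij]
    simp only [FPA.valij]
    rw [integral_mul_const, integral_congr_ae hxind, integral_indicator_one hwin]
  have hutil : FPA.EValij v μ i j - FPA.EPayij v μ i j =
      ∫ b, {p : ℝ × ℝ | p.2 ≤ p.1}.indicator (fun p => v i j - p.1)
        (b i j, FPA.maxOther i j b) ∂P := by
    have hval_int : Integrable (fun b => FPA.valij v b i j) P :=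
      FPA.integrable_xind_mul v i j (integrable_const (v i j))
    have hpay_int : Integrable (fun b => FPA.payij v b i j) P :=
      FPA.integrable_xind_mul v i j (FPA.integrable_bid hμ i j)
    rw [FPA.EValij, FPA.EPayij, ← integral_sub hval_int hpay_int]
    refine integral_congr_ae ?_
    filter_upwards [hxind] with b hb
    simp only [FPA.valij, FPA.payij, ← mul_sub, hb]
    by_cases h : FPA.maxOther i j b ≤ b i j <;> simp [Set.indicator, h]
  have hfixed : ∀ t, 0 ≤ t → (P.map (FPA.maxOther i j)).real (Set.Iic t) * (v i j - t) ≤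
      FPA.EValij v μ i j - FPA.EPayij v μ i j := fun t ht => by
    convert (hbest i hi).local_le hμ j ht using 2
    rw [map_measureReal_apply hD measurableSet_Iic,
      ← integral_indicator_one (hD measurableSet_Iic)]
    refine integral_congr_ae (ae_of_all _ fun b => ?_)
    have hiff := FPA.wins_rwinner_iff_maxOther_le
      (b := Function.update b i (Function.update (b i) j t)) hrw (by simpa using ht)
    rw [FPA.maxOther_update] at hiff
    simp [FPA.xind, hiff, Set.indicator]
  have hprobB : IsProbabilityMeasure (P.map fun b => b i j) :=
    Measure.isProbabilityMeasure_map hB.aemeasurable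
  have hprobD : IsProbabilityMeasure (P.map (FPA.maxOther i j)) :=
    Measure.isProbabilityMeasure_map hD.aemeasurable
  have hmain := FPA.le_integral_of_bid_law_optimal (P.map fun b => b i j)
    (P.map (FPA.maxOther i j)) (v := v i j)
    ((ae_map_iff hB.aemeasurable measurableSet_Ici).2
      ((FPA.ae_bid_nonneg hμ).mono fun b hb => hb i j))
    ((integrable_map_measure (g := fun x => x) aestronglyMeasurable_id hB.aemeasurable).2
      (FPA.integrable_bid hμ i j))
    ((integrable_map_measure (g := fun x => x) aestronglyMeasurable_id hD.aemeasurable).2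
      (FPA.integrable_maxOther hμ i j)) (hv i j)
  rw [hP, FPA.map_bid_prod_map_maxOther, ← hP, map_measureReal_apply hBD hle,
    integral_map hBD.aemeasurable (Measurable.aestronglyMeasurable
      (Measurable.indicator (by fun_prop) hle)),
    integral_map hBD.aemeasurable (Measurable.aestronglyMeasurable
      (Measurable.indicator (by fun_prop) hlt)), ← hutil] at hmain
  refine ⟨P.real {b | FPA.maxOther i j b ≤ b i j}, ⟨measureReal_nonneg, measureReal_le_one⟩, hval,
    (hmain hfixed).trans ?_⟩
  have hpay_int : ∀ k ∈ univ.erase i, Integrable (fun b => FPA.payij v b k j) P :=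
    fun k _ => FPA.integrable_xind_mul v k j (FPA.integrable_bid hμ k j)
  simp only [FPA.EPayij]
  rw [← integral_finsetSum _ hpay_int]
  refine integral_mono_ae ?_ (integrable_finsetSum _ hpay_int) ?_
  · exact (FPA.integrable_maxOther hμ i j).indicator (measurableSet_lt hB hD)
  · filter_upwards [FPA.ae_bid_nonneg hμ] with b hb
    simpa [Set.indicator] using FPA.le_sum_payij (v := v) (i := i) fun k => hb k j
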